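/- Let Ω ⊂ ℝ² be a domain and X = {x_1, …, x_n} ⊂ Ω̄ a point cloud of mesh size h, i.e. h is minimal such that Ω̄ is covered by the union of the closed balls B̄(x_i, h/2). Let γ = π/4 be the total opening angle of the 2d cone criterion, and let x_0 ∈ X be a point with B̄(x_0, r) ⊆ Ω̄ (a point sufficiently far from the boundary). If r > (1/sin(γ/2)) · (h/2), then the set of difference vectors {x − x_0 : x ∈ X ∩ B(x_0, r), x ≠ x_0} admits a positive Laplace stencil: there exist coefficients s_x ≥ 0 with Σ s_x (x − x_0) = 0 and Σ s_x (x − x_0)(x − x_0)^T = 2 I₂. -/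

import Mathlib

open Matrix BigOperators

/-- A disc of radius `0.3827` in the region `X² - Y² < βX`, `Y > 0`, inside the unit disc. -/
lemma disc_aux (β : ℝ) (hβ : 0 ≤ β) :
    ∃ c d : ℝ, c ^ 2 + d ^ 2 ≤ 0.381 ∧ ∀ X Y : ℝ,
      (X - c) ^ 2 + (Y - d) ^ 2 ≤ 0.3827 ^ 2 → 0 < Y ∧ X ^ 2 - Y ^ 2 - β * X < 0 := by
  have key : ∀ c d : ℝ, 0 ≤ c → 0.4 ≤ d → 0.293 ≤ d ^ 2 + 2 * c ^ 2 → ∀ X Y : ℝ,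
      (X - c) ^ 2 + (Y - d) ^ 2 ≤ 0.3827 ^ 2 → 0 < Y ∧ X ^ 2 - Y ^ 2 - 2 * c * X < 0 := by
    intro c d hc hd hcd X Y hXY
    constructor
    · by_contra hY
      push Not at hY
      nlinarith [sq_nonneg (X - c)]
    · nlinarith [sq_nonneg (2 * Y - d)]
  by_cases h1 : β / 2 ≤ 0.29
  · refine ⟨β / 2, 0.542, by nlinarith, fun X Y h => ?_⟩
    have := key (β / 2) 0.542 (by linarith) (by norm_num) (by nlinarith [sq_nonneg (β / 2)]) X Y h
    refine ⟨this.1, by linarith [this.2]⟩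
  by_cases h2 : β / 2 ≤ 0.4
  · push Not at h1
    refine ⟨β / 2, 0.4, by nlinarith, fun X Y h => ?_⟩
    have := key (β / 2) 0.4 (by linarith) (by norm_num) (by nlinarith) X Y h
    refine ⟨this.1, by linarith [this.2]⟩
  · push Not at h2
    refine ⟨0.4, 0.4, by norm_num, fun X Y h => ?_⟩
    have := key 0.4 0.4 (by norm_num) (by norm_num) (by norm_num) X Y h
    have hX : 0 < X := by
      by_contra hX
      push Not at hX
      nlinarith [sq_nonneg (Y - 0.4)]
    refine ⟨this.1, by nlinarith [this.2]⟩

lemma disc_diag (t R b₁ b₂ : ℝ) (ht : t < 0) (hR : 0 ≤ R) :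
    ∃ c d : ℝ, c ^ 2 + d ^ 2 ≤ 0.381 ∧ ∀ X Y : ℝ,
      (X - c) ^ 2 + (Y - d) ^ 2 ≤ 0.3827 ^ 2 →
      (t / 2 + R) * X ^ 2 + (t / 2 - R) * Y ^ 2 + b₁ * X + b₂ * Y < 0 := by
  have hk : 0 < R - t / 2 := by linarith
  obtain ⟨c, d, hcd, H⟩ := disc_aux (|b₁| / (R - t / 2)) (by positivity)
  have sgn : ∀ b : ℝ, ∃ s : ℝ, s ^ 2 = 1 ∧ b * s = -|b| := by
    intro b
    rcases le_total 0 b with h | h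
    · exact ⟨-1, by norm_num, by rw [abs_of_nonneg h]; ring⟩
    · exact ⟨1, by norm_num, by rw [abs_of_nonpos h]; ring⟩
  obtain ⟨s₁, hs₁, e₁⟩ := sgn b₁
  obtain ⟨s₂, hs₂, e₂⟩ := sgn b₂
  refine ⟨s₁ * c, s₂ * d, by rw [mul_pow, mul_pow, hs₁, hs₂]; linarith, fun X Y h => ?_⟩
  have hX : (s₁ * X - c) ^ 2 = (X - s₁ * c) ^ 2 := by
    linear_combination (X ^ 2 - c ^ 2) * hs₁
  have hY : (s₂ * Y - d) ^ 2 = (Y - s₂ * d) ^ 2 := by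
    linear_combination (Y ^ 2 - d ^ 2) * hs₂
  obtain ⟨hpos, hneg⟩ := H (s₁ * X) (s₂ * Y) (by rw [hX, hY]; exact h)
  have h1 : b₁ * X = -|b₁| * (s₁ * X) := by
    linear_combination (s₁ * X) * e₁ - b₁ * X * hs₁
  have h2 : b₂ * Y = -|b₂| * (s₂ * Y) := by
    linear_combination (s₂ * Y) * e₂ - b₂ * Y * hs₂
  have h3 : 0 ≤ |b₂| * (s₂ * Y) := by positivity
  have h4 := mul_neg_of_pos_of_neg hk hneg
  have h5 : (R - t / 2) * (|b₁| / (R - t / 2) * (s₁ * X)) = |b₁| * (s₁ * X) := by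
    rw [← mul_assoc, mul_div_cancel₀ _ hk.ne']
  rw [mul_pow, mul_pow, hs₁, hs₂] at h4
  rw [h1, h2]
  nlinarith [sq_nonneg X]

lemma disc_general (a m g b₁ b₂ : ℝ) (ht : a + g < 0) :
    ∃ p q : ℝ, p ^ 2 + q ^ 2 ≤ 0.381 ∧ ∀ x y : ℝ,
      (x - p) ^ 2 + (y - q) ^ 2 ≤ 0.3827 ^ 2 →
      a * x ^ 2 + m * (x * y) + g * y ^ 2 + b₁ * x + b₂ * y < 0 := by
  obtain ⟨R, C, S, hR, hCS, e1, e2⟩ : ∃ R C S : ℝ, 0 ≤ R ∧ C ^ 2 + S ^ 2 = 1 ∧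
      (a - g) / 2 = R * (C ^ 2 - S ^ 2) ∧ m / 2 = R * (2 * S * C) := by
    let z : ℂ := ⟨(a - g) / 2, m / 2⟩
    refine ⟨‖z‖, Real.cos (z.arg / 2), Real.sin (z.arg / 2), norm_nonneg _,
      Real.cos_sq_add_sin_sq _, ?_, ?_⟩
    · rw [← Real.cos_two_mul', mul_div_cancel₀ _ (two_ne_zero), Complex.norm_mul_cos_arg]
    · rw [← Real.sin_two_mul, mul_div_cancel₀ _ (two_ne_zero), Complex.norm_mul_sin_arg]
  obtain ⟨c, d, hcd, H⟩ := disc_diag (a + g) R (b₁ * C + b₂ * S) (b₂ * C - b₁ * S) ht hR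
  refine ⟨C * c - S * d, S * c + C * d, ?_, fun x y h => ?_⟩
  · have : (C * c - S * d) ^ 2 + (S * c + C * d) ^ 2 = c ^ 2 + d ^ 2 := by
      linear_combination (c ^ 2 + d ^ 2) * hCS
    linarith
  · have h1 := H (C * x + S * y) (C * y - S * x) (by
      have : (C * x + S * y - c) ^ 2 + (C * y - S * x - d) ^ 2 =
          (x - (C * c - S * d)) ^ 2 + (y - (S * c + C * d)) ^ 2 := by
        linear_combination (x ^ 2 + y ^ 2 - c ^ 2 - d ^ 2) * hCS
      rw [this]; exact h)
    have ha : a = (a + g) / 2 + R * (C ^ 2 - S ^ 2) := by linarith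
    have hg : g = (a + g) / 2 - R * (C ^ 2 - S ^ 2) := by linarith
    have hm : m = 2 * (R * (2 * S * C)) := by linarith
    generalize (a + g) / 2 = T at *
    subst hm
    rw [ha, hg]
    refine lt_of_le_of_lt (le_of_eq ?_) h1
    linear_combination (-T * (x ^ 2 + y ^ 2) - b₁ * x - b₂ * y) * hCS
      + 0 * hCS

lemma sin_bound : Real.sin (Real.pi / 4 / 2) < 0.3827 := by
  have : Real.pi / 4 / 2 = Real.pi / 8 := by ring
  rw [this, Real.sin_pi_div_eight]
  have h2 : (1.4142 : ℝ) < √2 := by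
    apply Real.lt_sqrt_of_sq_lt; norm_num
  have : √(2 - √2) < 0.7654 := by
    rw [Real.sqrt_lt' (by norm_num)]; norm_num at *; linarith
  linarith

/-- The feature vector (linear and quadratic monomials). -/
def feat (v : EuclideanSpace ℝ (Fin 2)) : Fin 5 → ℝ :=
  ![v 0, v 1, v 0 ^ 2, v 0 * v 1, v 1 ^ 2]

open scoped Classical in
/-- Theorem of alternatives. -/
lemma farkas (N : Finset (EuclideanSpace ℝ (Fin 2))) (x₀ : EuclideanSpace ℝ (Fin 2))
    (hN : x₀ ∉ N)
    (H : ∀ b₁ b₂ a m g : ℝ, a + g < 0 → ∃ x ∈ N,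
      a * (x 0 - x₀ 0) ^ 2 + m * ((x 0 - x₀ 0) * (x 1 - x₀ 1)) + g * (x 1 - x₀ 1) ^ 2
        + b₁ * (x 0 - x₀ 0) + b₂ * (x 1 - x₀ 1) < 0) :
    ∃ s : EuclideanSpace ℝ (Fin 2) → ℝ, (∀ x ∈ N, 0 ≤ s x) ∧
      ∀ i, ∑ x ∈ N, s x * feat (x - x₀) i = (![0, 0, 2, 0, 2] : Fin 5 → ℝ) i := by
  let T : Fin 5 → ℝ := ![0, 0, -2, 0, -2]
  let F : EuclideanSpace ℝ (Fin 2) → Fin 5 → ℝ := fun x => feat (x - x₀)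
  let S : Finset (Fin 5 → ℝ) := insert T (N.image F)
  have hinj : ∀ x ∈ N, ∀ y ∈ N, F x = F y → x = y := by
    intro x _ y _ h
    have h0 := congrFun h 0
    have h1 := congrFun h 1
    simp [F, feat] at h0 h1
    ext i; fin_cases i <;> simp [h0, h1]
  have hT : T ∉ N.image F := by
    intro h
    obtain ⟨x, _, hx⟩ := Finset.mem_image.1 h
    have h2 := congrFun hx 2
    simp [F, feat, T] at h2
    nlinarith [sq_nonneg (x 0 - x₀ 0)]
  by_cases h0 : (0 : Fin 5 → ℝ) ∈ convexHull ℝ (S : Set (Fin 5 → ℝ))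
  · obtain ⟨w, hw, hw1, hws⟩ := Finset.mem_convexHull'.1 h0
    rw [Finset.sum_insert hT, Finset.sum_image hinj] at hw1 hws
    have hwN : ∀ x ∈ N, 0 ≤ w (F x) := fun x hx =>
      hw _ (Finset.mem_insert_of_mem (Finset.mem_image_of_mem _ hx))
    have hwT : 0 ≤ w T := hw _ (Finset.mem_insert_self _ _)
    have hco : ∀ i, ∑ x ∈ N, w (F x) * F x i = - (w T * T i) := by
      intro i
      have := congrFun hws i
      simp only [Pi.add_apply, Finset.sum_apply, Pi.smul_apply, smul_eq_mul, Pi.zero_apply] at this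
      linarith
    have hpos : 0 < w T := by
      rcases hwT.lt_or_eq with h | h
      · exact h
      exfalso
      have hs : ∑ x ∈ N, w (F x) * (F x 2 + F x 4) = 0 := by
        simp only [mul_add, Finset.sum_add_distrib, hco, ← h]; simp
      have hFpos : ∀ x ∈ N, 0 < F x 2 + F x 4 := by
        intro x hx
        have hne : x ≠ x₀ := fun h => hN (h ▸ hx)
        simp only [F, feat]
        simp
        by_contra hcon
        push Not at hcon
        apply hne
        have h0 : x 0 - x₀ 0 = 0 := by
          have : (x 0 - x₀ 0) ^ 2 = 0 := by
            nlinarith [sq_nonneg (x 0 - x₀ 0), sq_nonneg (x 1 - x₀ 1)]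
          exact pow_eq_zero_iff (two_ne_zero) |>.1 this
        have h1 : x 1 - x₀ 1 = 0 := by
          have : (x 1 - x₀ 1) ^ 2 = 0 := by
            nlinarith [sq_nonneg (x 0 - x₀ 0), sq_nonneg (x 1 - x₀ 1)]
          exact pow_eq_zero_iff (two_ne_zero) |>.1 this
        ext i; fin_cases i <;> simp <;> linarith
      have hz := (Finset.sum_eq_zero_iff_of_nonneg
        (fun x hx => mul_nonneg (hwN x hx) (hFpos x hx).le)).1 hs
      have : ∑ x ∈ N, w (F x) = 0 := Finset.sum_eq_zero fun x hx =>
        (mul_eq_zero.1 (hz x hx)).resolve_right (hFpos x hx).ne'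
      linarith
    refine ⟨fun x => w (F x) / w T, fun x hx => div_nonneg (hwN x hx) hwT, fun i => ?_⟩
    have : ∑ x ∈ N, w (F x) / w T * feat (x - x₀) i = (∑ x ∈ N, w (F x) * F x i) / w T := by
      rw [Finset.sum_div]
      exact Finset.sum_congr rfl fun x _ => by simp only [F]; ring
    rw [this, hco, neg_div, mul_div_cancel_left₀ _ hpos.ne']
    fin_cases i <;> simp [T]
  · exfalso
    have hcl : IsClosed (convexHull ℝ (S : Set (Fin 5 → ℝ))) :=
      (S.finite_toSet.isCompact_convexHull ℝ).isClosed
    obtain ⟨f, u, hu, hf⟩ := geometric_hahn_banach_point_closed (convex_convexHull ℝ _) hcl h0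
    rw [map_zero] at hu
    have hfS : ∀ v ∈ S, 0 < f v := fun v hv => hu.trans (hf v (subset_convexHull ℝ _ hv))
    let e : Fin 5 → ℝ := fun i => f (Pi.single i 1)
    have hfe : ∀ v : Fin 5 → ℝ, f v = v 0 * e 0 + v 1 * e 1 + v 2 * e 2 + v 3 * e 3 + v 4 * e 4 := by
      intro v
      have := LinearMap.pi_apply_eq_sum_univ (f : (Fin 5 → ℝ) →ₗ[ℝ] ℝ) v
      simp only [Fin.sum_univ_five, smul_eq_mul] at this
      have he : ∀ i : Fin 5, (fun j => if i = j then (1:ℝ) else 0) = Pi.single i 1 := by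
        intro i; ext j; simp [Pi.single_apply, eq_comm]
      simp only [he] at this
      exact this
    have hTpos := hfS T (Finset.mem_insert_self _ _)
    rw [hfe] at hTpos
    simp [T] at hTpos
    obtain ⟨x, hx, hlt⟩ := H (e 0) (e 1) (e 2) (e 3) (e 4) (by linarith)
    have := hfS (F x) (Finset.mem_insert_of_mem (Finset.mem_image_of_mem _ hx))
    rw [hfe] at this
    simp [F, feat] at this
    linarith



open scoped Classical in
/-- Condition on a point cloud to guarantee positive stencils (2d): if `X ⊂ Ω̄` is a
point cloud of mesh size `h` (the least `h` such that `Ω̄` is covered by the closed balls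
`B̄(x, h/2)`, `x ∈ X`), `γ = π/4` is the opening angle of the 2d cone criterion,
`x₀ ∈ X` satisfies `B̄(x₀, r) ⊆ Ω̄` (it is sufficiently far from the boundary), and
`r > (1/sin(γ/2)) · (h/2)`, then the difference vectors to the neighbors of `x₀` in the
open ball `B(x₀, r)` admit a positive Laplace stencil. -/
theorem mesh_size_condition_positive_stencil_2d
    (Ω : Set (EuclideanSpace ℝ (Fin 2))) (hΩ : IsOpen Ω)
    (X : Finset (EuclideanSpace ℝ (Fin 2))) (hXΩ : (X : Set (EuclideanSpace ℝ (Fin 2))) ⊆ closure Ω)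
    (h r : ℝ)
    (hmesh : IsLeast {h' : ℝ |
      closure Ω ⊆ ⋃ x ∈ (X : Set (EuclideanSpace ℝ (Fin 2))), Metric.closedBall x (h' / 2)} h)
    (x₀ : EuclideanSpace ℝ (Fin 2)) (hx₀ : x₀ ∈ X)
    (hfar : Metric.closedBall x₀ r ⊆ closure Ω)
    (hr : 1 / Real.sin (Real.pi / 4 / 2) * (h / 2) < r) :
    ∃ s : EuclideanSpace ℝ (Fin 2) → ℝ,
      (∀ x ∈ X.filter (fun x => x ≠ x₀ ∧ dist x x₀ < r), 0 ≤ s x) ∧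
      (∑ x ∈ X.filter (fun x => x ≠ x₀ ∧ dist x x₀ < r), s x • (x - x₀)) = 0 ∧
      (∑ x ∈ X.filter (fun x => x ≠ x₀ ∧ dist x x₀ < r),
          s x • Matrix.of (fun a b => (x a - x₀ a) * (x b - x₀ b)))
        = (2 : ℝ) • (1 : Matrix (Fin 2) (Fin 2) ℝ) := by
  have hσ0 : 0 < Real.sin (Real.pi / 4 / 2) :=
    Real.sin_pos_of_pos_of_lt_pi (by positivity) (by linarith [Real.pi_pos])
  have hσ := sin_bound
  have hcov := hmesh.1
  simp only [Set.mem_setOf_eq] at hcov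
  have hh : 0 ≤ h / 2 := by
    have := hcov (hXΩ hx₀)
    simp only [Set.mem_iUnion, Metric.mem_closedBall] at this
    obtain ⟨y, _, hy⟩ := this
    exact dist_nonneg.trans hy
  have hr0 : 0 < r := lt_of_le_of_lt (by positivity) hr
  have hhr : h / 2 < 0.3827 * r := by
    rw [one_div, inv_mul_lt_iff₀ hσ0] at hr
    nlinarith
  have hdist : ∀ u v : EuclideanSpace ℝ (Fin 2),
      dist u v ^ 2 = (u 0 - v 0) ^ 2 + (u 1 - v 1) ^ 2 := by
    intro u v
    rw [EuclideanSpace.dist_eq, Real.sq_sqrt (by positivity), Fin.sum_univ_two,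
      Real.dist_eq, Real.dist_eq, sq_abs, sq_abs]
  obtain ⟨s, hs, hsum⟩ := farkas (X.filter (fun x => x ≠ x₀ ∧ dist x x₀ < r)) x₀ (by simp) (by
    intro b₁ b₂ a m g htr
    obtain ⟨p, q, hpq, hneg⟩ := disc_general (a * r ^ 2) (m * r ^ 2) (g * r ^ 2) (b₁ * r) (b₂ * r)
      (by nlinarith [pow_pos hr0 2])
    let c : EuclideanSpace ℝ (Fin 2) := !₂[x₀ 0 + r * p, x₀ 1 + r * q]
    have hc0 : c 0 = x₀ 0 + r * p := rfl
    have hc1 : c 1 = x₀ 1 + r * q := rfl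
    have hc : dist c x₀ ≤ 0.6173 * r := by
      apply abs_le_of_sq_le_sq' _ (by positivity) |>.2
      rw [hdist, hc0, hc1]
      nlinarith [pow_pos hr0 2]
    have hcΩ := hcov (hfar (Metric.mem_closedBall.2 (by linarith : dist c x₀ ≤ r)))
    simp only [Set.mem_iUnion, Metric.mem_closedBall] at hcΩ
    obtain ⟨x, hxX, hx⟩ := hcΩ
    rw [dist_comm] at hx
    have hxr : dist x x₀ < r := by
      have := dist_triangle x c x₀
      linarith
    have hq := hneg ((x 0 - x₀ 0) / r) ((x 1 - x₀ 1) / r) (by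
      have h1 : dist x c ^ 2 ≤ (0.3827 * r) ^ 2 :=
        pow_le_pow_left₀ dist_nonneg (by linarith) 2
      rw [hdist, hc0, hc1] at h1
      have h2 : ((x 0 - x₀ 0) / r - p) ^ 2 + ((x 1 - x₀ 1) / r - q) ^ 2 =
        ((x 0 - (x₀ 0 + r * p)) ^ 2 + (x 1 - (x₀ 1 + r * q)) ^ 2) / r ^ 2 := by
        field_simp; ring
      rw [h2, div_le_iff₀ (by positivity)]
      linarith)
    have hq' : a * (x 0 - x₀ 0) ^ 2 + m * ((x 0 - x₀ 0) * (x 1 - x₀ 1)) + g * (x 1 - x₀ 1) ^ 2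
        + b₁ * (x 0 - x₀ 0) + b₂ * (x 1 - x₀ 1) < 0 := by
      refine lt_of_le_of_lt (le_of_eq ?_) hq
      field_simp
    refine ⟨x, Finset.mem_filter.2 ⟨hxX, ?_, hxr⟩, hq'⟩
    rintro rfl
    simp at hq')
  have k0 := hsum 0
  have k1 := hsum 1
  have k2 := hsum 2
  have k3 := hsum 3
  have k4 := hsum 4
  simp [feat] at k0 k1 k2 k3 k4
  refine ⟨s, hs, ?_, ?_⟩
  · ext i
    rw [WithLp.ofLp_sum, Finset.sum_apply]
    fin_cases i
    · simpa using k0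
    · simpa using k1
  · ext i j
    rw [Matrix.sum_apply]
    fin_cases i <;> fin_cases j
    · simpa [pow_two] using k2
    · simpa using k3
    · simpa [mul_comm] using k3
    · simpa [pow_two] using k4
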